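/- Let γ_0,…,γ_{k−1} and δ_1,…,δ_k be positive reals, let T_k = L_k D_k L_k^T be the Jacobi matrix built from γ_0,…,γ_{k−1} and δ_1,…,δ_{k−1}, and set β_k = √δ_k/γ_{k−1}. Let T_k = S_k Θ_k S_k^T with S_k orthogonal, eigenvalues θ_1^{(k)} < ⋯ < θ_k^{(k)}, and last-row entries s_{k,i}^{(k)}. Define φ_0 = 1 and φ_j^{−1} = 1 + φ_{j−1}^{−1} δ_j for j = 1,…,k. Then for every μ with 0 < μ < θ_1^{(k)}, with α_{k+1}^{(μ)} = μ + β_k² e_k^T (T_k − μ I)^{−1} e_k and η_{i,k}^{(μ)} = (β_k s_{k,i}^{(k)})²/(θ_i^{(k)} − μ), one has α_{k+1}^{(μ)} − δ_k/γ_{k−1} = μ/φ_k + Σ_{i=1}^{k} (μ/θ_i^{(k)})² η_{i,k}^{(μ)}; equivalently, the Gauss–Radau coefficient γ_k^{(μ)} := (α_{k+1}^{(μ)} − δ_k/γ_{k−1})^{−1} satisfies (γ_k^{(μ)})^{−1} = μ/φ_k + Σ_{i=1}^{k} (μ/θ_i^{(k)})² η_{i,k}^{(μ)}. -/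

import Mathlib

open Matrix Finset

/-- The solution of the bidiagonal system `Lᵀ y = e` with subdiagonal `√δ`, together with its
squared norm, given by the recurrence `ψ_{j+1} = 1 + ψ_j δ_j`. -/
theorem exists_bidiagonal_solution (n : ℕ) (δ : Fin n → ℝ) (hδ : ∀ i, 0 ≤ δ i)
    (ψ : Fin (n + 1) → ℝ) (hψ0 : ψ 0 = 1)
    (hψ : ∀ j : Fin n, ψ j.succ = 1 + ψ j.castSucc * δ j) :
    ∃ y : Fin (n + 1) → ℝ, y (Fin.last n) = 1 ∧
      (∀ i : Fin n, y i.castSucc + Real.sqrt (δ i) * y i.succ = 0) ∧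
      ∑ i, y i ^ 2 = ψ (Fin.last n) := by
  induction n with
  | zero => exact ⟨fun _ => 1, rfl, fun i => i.elim0, by simpa using hψ0.symm⟩
  | succ n ih =>
    obtain ⟨y, hy1, hy2, hy3⟩ := ih (fun i => δ i.castSucc) (fun i => hδ _)
      (fun i => ψ i.castSucc) hψ0 (fun j => by simpa using hψ j.castSucc)
    refine ⟨Fin.snoc (fun i => -Real.sqrt (δ (Fin.last n)) * y i) 1, by simp, fun i => ?_, ?_⟩
    · refine Fin.lastCases ?_ (fun i => ?_) i
      · rw [Fin.snoc_castSucc (α := fun _ => ℝ), Fin.succ_last, Fin.snoc_last, hy1]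
        ring
      · rw [Fin.snoc_castSucc (α := fun _ => ℝ), Fin.succ_castSucc,
          Fin.snoc_castSucc (α := fun _ => ℝ)]
        linear_combination -Real.sqrt (δ (Fin.last n)) * hy2 i
    · have h := hψ (Fin.last n)
      rw [Fin.succ_last] at h
      simp only [Fin.sum_univ_castSucc, Fin.snoc_castSucc (α := fun _ => ℝ), Fin.snoc_last,
        mul_pow, neg_sq, Real.sq_sqrt (hδ _)] at hy3 ⊢
      rw [← Finset.mul_sum, h, ← hy3]
      ring

/-- A unit lower bidiagonal matrix fixes the last basis vector. -/
theorem bidiagonal_mulVec_single_last {k : ℕ} {L : Matrix (Fin (k + 1)) (Fin (k + 1)) ℝ}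
    (hLdiag : ∀ i, L i i = 1)
    (hLzero : ∀ i j : Fin (k + 1), (i : ℕ) ≠ (j : ℕ) → (i : ℕ) ≠ (j : ℕ) + 1 → L i j = 0) :
    L *ᵥ Pi.single (Fin.last k) 1 = Pi.single (Fin.last k) 1 := by
  ext i
  rw [Matrix.mulVec_single_one, Matrix.col_apply]
  by_cases hi : i = Fin.last k
  · subst hi; simp [hLdiag]
  · rw [Pi.single_eq_of_ne hi]
    have h : (i : ℕ) ≠ k := fun h => hi (Fin.ext h)
    have := i.isLt
    exact hLzero _ _ (by simpa using h) (by simp; omega)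

theorem bidiagonal_transpose_mulVec {k : ℕ} {L : Matrix (Fin (k + 1)) (Fin (k + 1)) ℝ}
    {δ : Fin k → ℝ} (hLdiag : ∀ i, L i i = 1)
    (hLsub : ∀ i : Fin k, L i.succ i.castSucc = Real.sqrt (δ i))
    (hLzero : ∀ i j : Fin (k + 1), (i : ℕ) ≠ (j : ℕ) → (i : ℕ) ≠ (j : ℕ) + 1 → L i j = 0)
    {y : Fin (k + 1) → ℝ} (hlast : y (Fin.last k) = 1)
    (hy : ∀ i : Fin k, y i.castSucc + Real.sqrt (δ i) * y i.succ = 0) :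
    Lᵀ *ᵥ y = Pi.single (Fin.last k) 1 := by
  ext j
  simp only [Matrix.mulVec, dotProduct, Matrix.transpose_apply]
  refine Fin.lastCases ?_ (fun j => ?_) j
  · rw [Finset.sum_eq_single (Fin.last k), hLdiag, hlast]
    · simp
    · intro i _ hi
      have h : (i : ℕ) ≠ k := fun h => hi (Fin.ext h)
      have := i.isLt
      rw [hLzero _ _ (by simpa using h) (by simp; omega), zero_mul]
    · simp
  · rw [Finset.sum_eq_add_of_mem j.castSucc j.succ (mem_univ _) (mem_univ _)
      (Fin.castSucc_lt_succ).ne, hLdiag, hLsub, one_mul, hy,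
      Pi.single_eq_of_ne (Fin.castSucc_lt_last j).ne]
    rintro i - ⟨h1, h2⟩
    rw [hLzero _ _ (fun h => h1 (Fin.ext h)) (fun h => h2 (Fin.ext (by simpa using h))), zero_mul]

theorem orthogonal_conj_diagonal_apply {n : Type*} [Fintype n] [DecidableEq n]
    (S : Matrix n n ℝ) (d : n → ℝ) (i j : n) :
    (S * Matrix.diagonal d * Sᵀ) i j = ∑ l, S i l * d l * S j l := by
  simp [Matrix.mul_apply, Matrix.diagonal_apply]

/-- The inverse of a shifted, orthogonally diagonalized matrix. -/
theorem inv_orthogonal_conj_sub_smul {n : Type*} [Fintype n] [DecidableEq n]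
    {S : Matrix n n ℝ} (hS : S * Sᵀ = 1) {θ : n → ℝ} {μ : ℝ} (hμ : ∀ i, θ i - μ ≠ 0) :
    (S * Matrix.diagonal θ * Sᵀ - μ • (1 : Matrix n n ℝ))⁻¹
      = S * Matrix.diagonal (fun i => (θ i - μ)⁻¹) * Sᵀ := by
  have hS' : Sᵀ * S = 1 := mul_eq_one_comm.mp hS
  have h : S * Matrix.diagonal θ * Sᵀ - μ • (1 : Matrix n n ℝ)
      = S * Matrix.diagonal (fun i => θ i - μ) * Sᵀ := by
    have : Matrix.diagonal (fun i => θ i - μ) = Matrix.diagonal θ - μ • (1 : Matrix n n ℝ) := by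
      ext i j
      by_cases hij : i = j
      · subst hij; simp
      · simp [hij]
    rw [this, mul_sub, sub_mul, mul_smul_comm, mul_one, smul_mul_assoc, hS]
  refine Matrix.inv_eq_right_inv ?_
  rw [h, show S * Matrix.diagonal (fun i => θ i - μ) * Sᵀ *
      (S * Matrix.diagonal (fun i => (θ i - μ)⁻¹) * Sᵀ) =
      S * (Matrix.diagonal (fun i => θ i - μ) * (Sᵀ * S) *
        Matrix.diagonal (fun i => (θ i - μ)⁻¹)) * Sᵀ by simp only [mul_assoc],
    hS', mul_one, Matrix.diagonal_mul_diagonal]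
  simp [mul_inv_cancel₀ (hμ _), hS]

/-- Theorem `gammamu`: for `0 < μ < θ 0`,
`(γ_k^{(μ)})⁻¹ = α_{k+1}^{(μ)} - δ_k/γ_{k-1} = μ/φ_k + ∑ᵢ (μ/θᵢ)² η_{i,k}^{(μ)}`. -/
theorem stmt14
    (k : ℕ) (γ : Fin (k + 1) → ℝ) (δ : Fin k → ℝ) (δk μ : ℝ)
    (hγ : ∀ i, 0 < γ i) (hδ : ∀ i, 0 < δ i) (hδk : 0 < δk)
    (L T S : Matrix (Fin (k + 1)) (Fin (k + 1)) ℝ)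
    (θ : Fin (k + 1) → ℝ) (φ : Fin (k + 2) → ℝ)
    (hLdiag : ∀ i, L i i = 1)
    (hLsub : ∀ i : Fin k, L i.succ i.castSucc = Real.sqrt (δ i))
    (hLzero : ∀ i j : Fin (k + 1), (i : ℕ) ≠ (j : ℕ) → (i : ℕ) ≠ (j : ℕ) + 1 → L i j = 0)
    (hT : T = L * Matrix.diagonal (fun i => (γ i)⁻¹) * Lᵀ)
    (hθ : StrictMono θ) (hS : S * Sᵀ = 1) (hspec : T = S * Matrix.diagonal θ * Sᵀ)
    (β : ℝ) (hβ : β = Real.sqrt δk / γ (Fin.last k))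
    (hφ0 : φ 0 = 1)
    (hφ : ∀ j : Fin (k + 1), (φ j.succ)⁻¹ = 1 + (φ j.castSucc)⁻¹ *
      (Fin.snoc (fun i : Fin k => δ i) δk : Fin (k + 1) → ℝ) j)
    (hμ0 : 0 < μ) (hμ : μ < θ 0)
    (η : Fin (k + 1) → ℝ)
    (hη : ∀ i, η i = (β * S (Fin.last k) i) ^ 2 / (θ i - μ))
    (αμ : ℝ)
    (hαμ : αμ = μ + β ^ 2 *
      (Pi.single (Fin.last k) 1 ⬝ᵥ (T - μ • 1)⁻¹ *ᵥ Pi.single (Fin.last k) 1))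
    (γμ : ℝ) (hγμ : γμ = (αμ - δk / γ (Fin.last k))⁻¹) :
    αμ - δk / γ (Fin.last k)
      = μ / φ (Fin.last (k + 1)) + ∑ i, (μ / θ i) ^ 2 * η i ∧
    γμ⁻¹ = μ / φ (Fin.last (k + 1)) + ∑ i, (μ / θ i) ^ 2 * η i := by
  have hθ0 : ∀ i, μ < θ i := fun i => hμ.trans_le (hθ.monotone (Fin.zero_le i))
  have hθpos : ∀ i, θ i ≠ 0 := fun i => (hμ0.trans (hθ0 i)).ne'
  have hθμ : ∀ i, θ i - μ ≠ 0 := fun i => (sub_pos.mpr (hθ0 i)).ne'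
  have hS' : Sᵀ * S = 1 := mul_eq_one_comm.mp hS
  set g := γ (Fin.last k) with hg
  have hg0 : g ≠ 0 := (hγ _).ne'
  obtain ⟨y, hy1, hy2, hy3⟩ := exists_bidiagonal_solution k δ (fun i => (hδ i).le)
    (fun i => (φ i.castSucc)⁻¹) (by simp [hφ0])
    (fun j => by simpa using hφ j.castSucc)
  have hTy : T *ᵥ y = g⁻¹ • Pi.single (Fin.last k) 1 := by
    rw [hT, ← Matrix.mulVec_mulVec, ← Matrix.mulVec_mulVec,
      bidiagonal_transpose_mulVec hLdiag hLsub hLzero hy1 hy2, Matrix.diagonal_mulVec_single,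
      mul_one, ← hg, show (Pi.single (Fin.last k) g⁻¹ : Fin (k + 1) → ℝ)
        = g⁻¹ • Pi.single (Fin.last k) 1 by rw [← Pi.single_smul]; simp,
      Matrix.mulVec_smul, bidiagonal_mulVec_single_last hLdiag hLzero]
  have hz : ∀ i, (Sᵀ *ᵥ y) i = g⁻¹ * S (Fin.last k) i / θ i := by
    intro i
    have h := congrFun (congrArg (Sᵀ *ᵥ ·) hTy) i
    simp only [hspec, Matrix.mulVec_mulVec, Matrix.mulVec_smul] at h
    rw [mul_assoc S, ← mul_assoc, hS', one_mul, ← Matrix.mulVec_mulVec,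
      Matrix.mulVec_diagonal] at h
    simp at h
    rw [eq_div_iff (hθpos i), mul_comm, h]
  have hySz : y = S *ᵥ (Sᵀ *ᵥ y) := by rw [Matrix.mulVec_mulVec, hS, Matrix.one_mulVec]
  have hsum1 : ∑ i, S (Fin.last k) i ^ 2 / θ i = g := by
    have h : y (Fin.last k) = S (Fin.last k) ⬝ᵥ (Sᵀ *ᵥ y) := congrFun hySz (Fin.last k)
    rw [hy1] at h
    simp only [dotProduct, hz] at h
    have h' : (1 : ℝ) = g⁻¹ * ∑ i, S (Fin.last k) i ^ 2 / θ i := by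
      rw [h, Finset.mul_sum]
      exact Finset.sum_congr rfl fun i _ => by ring
    field_simp at h'
    exact h'.symm
  have hsum2 : ∑ i, S (Fin.last k) i ^ 2 / θ i ^ 2
      = g ^ 2 * (φ (Fin.last k).castSucc)⁻¹ := by
    have h : y ⬝ᵥ y = (Sᵀ *ᵥ y) ⬝ᵥ (Sᵀ *ᵥ y) := by
      rw [Matrix.dotProduct_mulVec, Matrix.vecMul_transpose, ← hySz]
    simp only [dotProduct, hz, ← pow_two] at h
    rw [← hy3, h, Finset.mul_sum]
    exact Finset.sum_congr rfl fun i _ => by field_simp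
  have hres : Pi.single (Fin.last k) 1 ⬝ᵥ (T - μ • 1)⁻¹ *ᵥ Pi.single (Fin.last k) 1
      = ∑ i, S (Fin.last k) i ^ 2 / (θ i - μ) := by
    rw [hspec, inv_orthogonal_conj_sub_smul hS hθμ, single_one_dotProduct,
      Matrix.mulVec_single_one, Matrix.col_apply, orthogonal_conj_diagonal_apply]
    exact Finset.sum_congr rfl fun i _ => by ring
  have hβ2 : β ^ 2 = δk / g ^ 2 := by rw [hβ, div_pow, Real.sq_sqrt hδk.le]
  have hsplit : β ^ 2 * ∑ i, S (Fin.last k) i ^ 2 / (θ i - μ)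
      = β ^ 2 * ∑ i, S (Fin.last k) i ^ 2 / θ i
        + μ * β ^ 2 * ∑ i, S (Fin.last k) i ^ 2 / θ i ^ 2 + ∑ i, (μ / θ i) ^ 2 * η i := by
    simp only [Finset.mul_sum, ← Finset.sum_add_distrib, hη]
    refine Finset.sum_congr rfl fun i _ => ?_
    have h1 := hθpos i
    have h2 := hθμ i
    field_simp
    ring
  have hφk := hφ (Fin.last k)
  rw [Fin.succ_last, Fin.snoc_last] at hφk
  have main : αμ - δk / g = μ / φ (Fin.last (k + 1)) + ∑ i, (μ / θ i) ^ 2 * η i := by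
    rw [hαμ, hres, hsplit, hsum1, hsum2, hβ2, div_eq_mul_inv μ, hφk]
    field_simp
    ring
  exact ⟨main, by rw [hγμ, inv_inv, main]⟩
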